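/- Let d ≥ 2. For every integer L ≥ 1: the partition function satisfies 0 < Z_L(p) < ∞ for every p ∈ ℝ^d; the finite-volume surface tension σ_L is differentiable on ℝ^d; and for every p ∈ ℝ^d and every i ∈ {1,…,d}: ∂σ_L/∂p_i(p) = Z_L(p)^{−1} ∫_{Ω°_L} [(2L+1)^{−d} Σ_{x∈𝕋_L} V'(p_i + φ(x+u_i) − φ(x))] e^{−H_{L,p}(φ)} dλ_L(φ), i.e. the gradient of σ_L at p equals the expectation under the Gibbs measure μ_{L,p} of the spatially averaged flux V'(p + ∇φ). -/

import Mathlib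

open MeasureTheory ProbabilityTheory Filter
open scoped ENNReal

noncomputable section

/-- The discrete torus `(ℤ/(2L+1)ℤ)^d`. -/
abbrev Torus (d L : ℕ) : Type := Fin d → ZMod (2 * L + 1)

/-- The `i`-th unit coordinate vector of the discrete torus. -/
def uvec (d L : ℕ) (i : Fin d) : Torus d L := fun j => if j = i then 1 else 0

/-- Summation over the torus, as a linear functional on `ℝ^{𝕋_L}`. -/
def torusSum (d L : ℕ) : EuclideanSpace ℝ (Torus d L) →ₗ[ℝ] ℝ where
  toFun f := ∑ x, f x
  map_add' f g := by
    simp [PiLp.add_apply, Finset.sum_add_distrib]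
  map_smul' c f := by
    simp [PiLp.smul_apply, smul_eq_mul, Finset.mul_sum]

/-- The hyperplane `Ω°_L` of configurations with zero mean; as a subspace of a Euclidean
space it carries its Lebesgue (Haar) measure `volume`. -/
def OmegaZero (d L : ℕ) : Submodule ℝ (EuclideanSpace ℝ (Torus d L)) :=
  LinearMap.ker (torusSum d L)

/-- View an element of `Ω°_L` as a field on the torus. -/
def fieldOf (d L : ℕ) (φ : ↥(OmegaZero d L)) : Torus d L → ℝ :=
  fun x => (φ : EuclideanSpace ℝ (Torus d L)) x

/-- The Hamiltonian `H_{L,p}(φ) = Σ_x Σ_i V(p_i + φ(x+u_i) - φ(x))`. -/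
def hamiltonian (d L : ℕ) (V : ℝ → ℝ) (p : Fin d → ℝ) (φ : Torus d L → ℝ) : ℝ :=
  ∑ x : Torus d L, ∑ i : Fin d, V (p i + φ (x + uvec d L i) - φ x)

/-- The partition function `Z_L(p) = ∫_{Ω°_L} exp(-H_{L,p}(φ)) dλ_L(φ)`. -/
def partitionZ (d L : ℕ) (V : ℝ → ℝ) (p : Fin d → ℝ) : ℝ :=
  ∫ φ : ↥(OmegaZero d L), Real.exp (-(hamiltonian d L V p (fieldOf d L φ)))

/-- The finite-volume surface tension `σ_L(p) = -(2L+1)^{-d} log Z_L(p)`. -/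
def sigmaL (d L : ℕ) (V : ℝ → ℝ) (p : Fin d → ℝ) : ℝ :=
  -(((2 * (L : ℝ) + 1) ^ d)⁻¹) * Real.log (partitionZ d L V p)

section GibbsIntegral

variable {E : Type*} [NormedAddCommGroup E] [InnerProductSpace ℝ E] [FiniteDimensional ℝ E]
  {F : Type*} [NormedAddCommGroup F] [NormedSpace ℝ F]
  {P : Type*} [NormedAddCommGroup P] [NormedSpace ℝ P]

/-- A Gaussian lower bound, locally uniform in the parameter, for an energy with quadratic growth
composed with an injective linear map. -/
theorem exists_energy_lower_bound {G : F → ℝ} {c a : ℝ} (ha : 0 < a)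
    (hG : ∀ y, c + a * ‖y‖ ^ 2 ≤ G y) (T : E →L[ℝ] F) (hT : Function.Injective T)
    (A : P →L[ℝ] F) (R : ℝ) :
    ∃ b > 0, ∃ c' : ℝ, ∀ p, ‖p‖ ≤ R → ∀ φ,
      c' + a / 2 * ‖A p + T φ‖ ^ 2 + b * ‖φ‖ ^ 2 ≤ G (A p + T φ) := by
  obtain ⟨K, hK, hKT⟩ := (T : E →ₗ[ℝ] F).exists_antilipschitzWith (LinearMap.ker_eq_bot.2 hT)
  have hK' : (0 : ℝ) < K := hK
  refine ⟨a / (4 * (K : ℝ) ^ 2), by positivity, c - a / 2 * (‖A‖ * R) ^ 2, fun p hp φ => ?_⟩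
  set y := A p + T φ with hy
  have h1 : ‖φ‖ ≤ K * ‖T φ‖ := by
    simpa using hKT.le_mul_dist φ 0
  have h2 : ‖A p‖ ≤ ‖A‖ * R := (A.le_opNorm p).trans (by gcongr)
  have h3 : ‖T φ‖ ≤ ‖y‖ + ‖A‖ * R := by
    calc ‖T φ‖ = ‖y - A p‖ := by rw [hy, add_sub_cancel_left]
      _ ≤ ‖y‖ + ‖A p‖ := norm_sub_le _ _
      _ ≤ _ := by gcongr
  have h4 : ‖T φ‖ ^ 2 ≤ 2 * ‖y‖ ^ 2 + 2 * (‖A‖ * R) ^ 2 := by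
    have := pow_le_pow_left₀ (norm_nonneg _) h3 2
    nlinarith [sq_nonneg (‖y‖ - ‖A‖ * R)]
  have h5 : a / (4 * (K : ℝ) ^ 2) * ‖φ‖ ^ 2 ≤ a / 4 * ‖T φ‖ ^ 2 := by
    have := pow_le_pow_left₀ (norm_nonneg _) h1 2
    calc a / (4 * (K : ℝ) ^ 2) * ‖φ‖ ^ 2 ≤ a / (4 * (K : ℝ) ^ 2) * (K * ‖T φ‖) ^ 2 := by gcongr
      _ = _ := by field_simp
  have h6 := hG y
  nlinarith

variable [MeasurableSpace E] [BorelSpace E]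

theorem integrable_exp_neg_mul_sq_norm {b : ℝ} (hb : 0 < b) :
    Integrable (fun v : E => Real.exp (-b * ‖v‖ ^ 2)) := by
  have h := (GaussianFourier.integrable_cexp_neg_mul_sq_norm_add (V := E)
    (b := (b : ℂ)) (by simpa using hb) 0 0).norm
  refine h.congr (Eventually.of_forall fun v => ?_)
  simp only [Complex.norm_exp]
  norm_cast
  simp

theorem integrable_exp_neg_energy {G : F → ℝ} (hGc : Continuous G) {c a : ℝ} (ha : 0 < a)
    (hG : ∀ y, c + a * ‖y‖ ^ 2 ≤ G y) (T : E →L[ℝ] F) (hT : Function.Injective T) (z : F) :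
    Integrable (fun φ : E => Real.exp (-G (z + T φ))) := by
  obtain ⟨b, hb, c', h⟩ :=
    exists_energy_lower_bound ha hG T hT (ContinuousLinearMap.id ℝ F) ‖z‖
  refine ((integrable_exp_neg_mul_sq_norm (E := E) hb).const_mul (Real.exp (-c'))).mono'
    (by fun_prop) (Eventually.of_forall fun φ => ?_)
  rw [Real.norm_eq_abs, Real.abs_exp, ← Real.exp_add, Real.exp_le_exp]
  have h1 := h z le_rfl φ
  simp only [ContinuousLinearMap.id_apply] at h1
  have : 0 ≤ a / 2 * ‖z + T φ‖ ^ 2 := by positivity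
  linarith

theorem exists_le_mul_exp_sq {a : ℝ} (ha : 0 < a) :
    ∃ M ≥ 0, ∀ t : ℝ, t ≤ M * Real.exp (a * t ^ 2) := by
  refine ⟨1 + 1 / a, by positivity, fun t => ?_⟩
  have h1 := Real.add_one_le_exp (a * t ^ 2)
  calc t ≤ (1 + 1 / a) * (a * t ^ 2 + 1) := by
        have : (1 + 1 / a) * (a * t ^ 2 + 1) = a * t ^ 2 + 1 + t ^ 2 + 1 / a := by
          field_simp; ring
        rw [this]
        have : 0 < 1 / a := by positivity
        nlinarith [sq_nonneg (t - 1), mul_nonneg ha.le (sq_nonneg t)]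
    _ ≤ _ := by gcongr

/-- Differentiation under the integral sign for the partition function of an energy with quadratic
growth and at most linearly growing gradient. -/
theorem hasFDerivAt_integral_exp_neg_energy {G : F → ℝ} {G' : F → F →L[ℝ] ℝ}
    (hGd : ∀ y, HasFDerivAt G (G' y) y) (hG'c : Continuous G') {c a B : ℝ} (ha : 0 < a)
    (hB : 0 ≤ B) (hG : ∀ y, c + a * ‖y‖ ^ 2 ≤ G y) (hG' : ∀ y, ‖G' y‖ ≤ B * ‖y‖)
    (T : E →L[ℝ] F) (hT : Function.Injective T) (A : P →L[ℝ] F) (p : P) :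
    Integrable (fun φ : E => Real.exp (-G (A p + T φ)) • (-((G' (A p + T φ)).comp A))) ∧
    HasFDerivAt (fun p => ∫ φ : E, Real.exp (-G (A p + T φ)))
      (∫ φ : E, Real.exp (-G (A p + T φ)) • (-((G' (A p + T φ)).comp A))) p := by
  have hGc : Continuous G := continuous_iff_continuousAt.2 fun y => (hGd y).continuousAt
  obtain ⟨b, hb, c', h⟩ := exists_energy_lower_bound ha hG T hT A (‖p‖ + 1)
  obtain ⟨M, hM, hMt⟩ := exists_le_mul_exp_sq (half_pos ha)
  set bound : E → ℝ := fun φ => (B * M * ‖A‖ * Real.exp (-c')) * Real.exp (-b * ‖φ‖ ^ 2)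
  have hbound : ∀ φ : E, ∀ q ∈ Metric.ball p 1,
      ‖Real.exp (-G (A q + T φ)) • (-((G' (A q + T φ)).comp A))‖ ≤ bound φ := by
    intro φ q hq
    have hq' : ‖q‖ ≤ ‖p‖ + 1 := by
      have h1 : ‖q - p‖ < 1 := by simpa [dist_eq_norm] using hq
      have h2 := norm_le_norm_add_norm_sub' q p
      linarith
    have h1 := h q hq' φ
    set y := A q + T φ
    calc ‖Real.exp (-G y) • (-((G' y).comp A))‖
        = Real.exp (-G y) * ‖(G' y).comp A‖ := by
          rw [norm_smul, norm_neg, Real.norm_eq_abs, Real.abs_exp]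
      _ ≤ Real.exp (-(c' + a / 2 * ‖y‖ ^ 2 + b * ‖φ‖ ^ 2)) *
          ((B * (M * Real.exp (a / 2 * ‖y‖ ^ 2))) * ‖A‖) := by
          gcongr
          refine ((G' y).opNorm_comp_le A).trans ?_
          gcongr
          exact (hG' y).trans (by gcongr; exact hMt _)
      _ = bound φ := by
          have : -(c' + a / 2 * ‖y‖ ^ 2 + b * ‖φ‖ ^ 2)
              = -c' + -b * ‖φ‖ ^ 2 + -(a / 2 * ‖y‖ ^ 2) := by ring
          rw [this, Real.exp_add, Real.exp_add, Real.exp_neg (a / 2 * ‖y‖ ^ 2)]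
          simp only [bound]
          field_simp
  have hbi : Integrable bound := (integrable_exp_neg_mul_sq_norm (E := E) hb).const_mul _
  have hmeas : AEStronglyMeasurable
      (fun φ : E => Real.exp (-G (A p + T φ)) • (-((G' (A p + T φ)).comp A))) := by
    refine Continuous.aestronglyMeasurable ?_
    have : Continuous fun φ : E => (G' (A p + T φ)).comp A :=
      (hG'c.comp (by fun_prop)).clm_comp continuous_const
    fun_prop
  refine ⟨hbi.mono' hmeas (Eventually.of_forall fun φ => hbound φ p (Metric.mem_ball_self one_pos)),
    hasFDerivAt_integral_of_dominated_of_fderiv_le (Metric.ball_mem_nhds p one_pos)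
    (Eventually.of_forall fun q => (by fun_prop : Continuous _).aestronglyMeasurable)
    (integrable_exp_neg_energy hGc ha hG T hT _) hmeas
    (Eventually.of_forall hbound) hbi (Eventually.of_forall fun φ q _ => ?_)⟩
  have h1 : HasFDerivAt (fun q => A q + T φ) A q := A.hasFDerivAt.add_const _
  exact (((hGd _).comp q h1).neg).exp

end GibbsIntegral

section SeparableEnergy

variable {ι : Type*} [Fintype ι]

theorem sq_norm_pi_le_sum_sq (y : ι → ℝ) : ‖y‖ ^ 2 ≤ ∑ k, y k ^ 2 := by
  have h : ‖y‖ ≤ Real.sqrt (∑ k, y k ^ 2) := by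
    refine (pi_norm_le_iff_of_nonneg (Real.sqrt_nonneg _)).2 fun k => ?_
    rw [Real.norm_eq_abs]
    exact Real.abs_le_sqrt
      (Finset.single_le_sum (f := fun k => y k ^ 2) (fun _ _ => sq_nonneg _) (Finset.mem_univ k))
  calc ‖y‖ ^ 2 ≤ Real.sqrt (∑ k, y k ^ 2) ^ 2 := by gcongr
    _ = _ := Real.sq_sqrt (Finset.sum_nonneg fun _ _ => sq_nonneg _)

theorem hasFDerivAt_sum_comp_apply {V V' : ℝ → ℝ} (hV' : ∀ x, HasDerivAt V (V' x) x)
    (y : ι → ℝ) :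
    HasFDerivAt (fun y : ι → ℝ => ∑ k, V (y k))
      (∑ k, V' (y k) • (ContinuousLinearMap.proj k : (ι → ℝ) →L[ℝ] ℝ)) y := by
  refine HasFDerivAt.fun_sum fun k _ => ?_
  exact (hV' (y k)).comp_hasFDerivAt y (hasFDerivAt_apply k y)

theorem norm_sum_smul_proj_le {W : ℝ → ℝ} {B : ℝ} (hB : 0 ≤ B) (hW : ∀ x, |W x| ≤ B * |x|)
    (y : ι → ℝ) :
    ‖∑ k, W (y k) • (ContinuousLinearMap.proj k : (ι → ℝ) →L[ℝ] ℝ)‖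
      ≤ Fintype.card ι * B * ‖y‖ := by
  have hproj (k : ι) : ‖(ContinuousLinearMap.proj k : (ι → ℝ) →L[ℝ] ℝ)‖ ≤ 1 :=
    ContinuousLinearMap.opNorm_le_bound _ zero_le_one fun z => by
      simpa using norm_le_pi_norm z k
  calc _ ≤ ∑ _k : ι, B * ‖y‖ := by
        refine norm_sum_le_of_le _ fun k _ => ?_
        rw [norm_smul]
        calc ‖W (y k)‖ * _ ≤ (B * ‖y‖) * 1 := by
              gcongr
              · exact (hW _).trans (by gcongr; exact norm_le_pi_norm y k)
              · exact hproj k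
          _ = _ := mul_one _
    _ = _ := by simp [mul_assoc]

end SeparableEnergy

section Potential

variable {V V' : ℝ → ℝ}

theorem deriv_zero_of_symmetric (hsymm : ∀ x, V (-x) = V x) (hV' : ∀ x, HasDerivAt V (V' x) x) :
    V' 0 = 0 := by
  have h : HasDerivAt (fun x => V (-x)) (V' (-0) * -1) 0 :=
    (hV' (-0)).comp 0 (hasDerivAt_neg 0)
  simp only [hsymm, neg_zero] at h
  have := h.unique (hV' 0)
  linarith

theorem quadratic_lower_bound {cm : ℝ} (hsymm : ∀ x, V (-x) = V x)
    (hV' : ∀ x, HasDerivAt V (V' x) x)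
    (hconv : ∀ a b : ℝ, a ≤ b → cm * (b - a) ≤ V' b - V' a) (x : ℝ) :
    V 0 + cm / 2 * x ^ 2 ≤ V x := by
  have h0 := deriv_zero_of_symmetric hsymm hV'
  have hd (t : ℝ) : HasDerivAt (fun t => V t - cm / 2 * t ^ 2) (V' t - cm * t) t := by
    have := (hV' t).sub ((hasDerivAt_pow 2 t).const_mul (cm / 2))
    convert! this using 1
    simp; ring
  have hmono : MonotoneOn (fun t => V t - cm / 2 * t ^ 2) (Set.Ici 0) := by
    refine monotoneOn_of_deriv_nonneg (convex_Ici 0)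
      (fun t _ => (hd t).continuousAt.continuousWithinAt)
      (fun t _ => (hd t).differentiableAt.differentiableWithinAt) fun t ht => ?_
    rw [interior_Ici] at ht
    rw [(hd t).deriv]
    have := hconv 0 t ht.le
    simp only [h0, sub_zero] at this
    linarith
  have habs : V |x| = V x := by
    rcases abs_choice x with h | h <;> rw [h]
    exact hsymm x
  have := hmono (Set.self_mem_Ici) (Set.mem_Ici.2 (abs_nonneg x)) (abs_nonneg x)
  simp only [habs, sq_abs] at this
  linarith

theorem abs_deriv_le {cm cp : ℝ} (hc : 0 < cm) (hsymm : ∀ x, V (-x) = V x)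
    (hV' : ∀ x, HasDerivAt V (V' x) x)
    (hconv : ∀ a b : ℝ, a ≤ b →
      cm * (b - a) ≤ V' b - V' a ∧ V' b - V' a ≤ cp * (b - a)) (x : ℝ) :
    |V' x| ≤ cp * |x| := by
  have h0 := deriv_zero_of_symmetric hsymm hV'
  rcases le_total 0 x with hx | hx
  · obtain ⟨h1, h2⟩ := hconv 0 x hx
    rw [h0] at h1 h2
    rw [abs_of_nonneg hx, abs_of_nonneg (by nlinarith)]
    linarith
  · obtain ⟨h1, h2⟩ := hconv x 0 hx
    rw [h0] at h1 h2
    rw [abs_of_nonpos hx, abs_of_nonpos (by nlinarith)]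
    linarith

theorem continuous_deriv_of_bounds {cm cp : ℝ} (hc : 0 < cm)
    (hconv : ∀ a b : ℝ, a ≤ b →
      cm * (b - a) ≤ V' b - V' a ∧ V' b - V' a ≤ cp * (b - a)) : Continuous V' := by
  have hcp : 0 ≤ cp := by
    obtain ⟨h1, h2⟩ := hconv 0 1 zero_le_one
    linarith
  refine (LipschitzWith.of_le_add_mul' cp fun x y => ?_).continuous
  rw [Real.dist_eq]
  rcases le_total x y with h | h
  · have h1 := (hconv x y h).1
    have : 0 ≤ cp * |x - y| := by positivity
    nlinarith
  · have h2 := (hconv y x h).2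
    rw [abs_of_nonneg (sub_nonneg.2 h)]
    linarith

end Potential

section Torus

/-- The discrete gradient on `Ω°_L`, as a continuous linear map. -/
def discreteGrad (d L : ℕ) : ↥(OmegaZero d L) →L[ℝ] (Torus d L × Fin d → ℝ) :=
  LinearMap.toContinuousLinearMap
    { toFun := fun φ k => fieldOf d L φ (k.1 + uvec d L k.2) - fieldOf d L φ k.1
      map_add' := fun φ ψ => by
        ext k
        simp [fieldOf]
        ring
      map_smul' := fun c φ => by
        ext k
        simp [fieldOf]
        ring }

@[simp]
theorem discreteGrad_apply (d L : ℕ) (φ : ↥(OmegaZero d L)) (k : Torus d L × Fin d) :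
    discreteGrad d L φ k = fieldOf d L φ (k.1 + uvec d L k.2) - fieldOf d L φ k.1 := rfl

/-- A function on the torus invariant under all unit translations is constant. -/
theorem eq_of_forall_add_uvec_eq {d L : ℕ} {f : Torus d L → ℝ}
    (hf : ∀ x i, f (x + uvec d L i) = f x) (x : Torus d L) : f x = f 0 := by
  have hn : ∀ (n : ℕ) (i : Fin d) (y : Torus d L), f (y + n • uvec d L i) = f y := by
    intro n i y
    induction n with
    | zero => simp
    | succ n ih => rw [succ_nsmul, ← add_assoc, hf, ih]
  have hs : ∀ s : Finset (Fin d), f (∑ i ∈ s, (x i).val • uvec d L i) = f 0 := by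
    intro s
    induction s using Finset.induction_on with
    | empty => simp
    | insert i s hi ih => rw [Finset.sum_insert hi, add_comm, hn, ih]
  have hx : ∑ i, (x i).val • uvec d L i = x := by
    ext j
    simp [uvec, Finset.sum_apply, -nsmul_eq_mul, Pi.smul_apply]
  rw [← hs Finset.univ, hx]

theorem discreteGrad_injective (d L : ℕ) : Function.Injective (discreteGrad d L) := by
  refine (injective_iff_map_eq_zero _).2 fun φ hφ => ?_
  have hconst := eq_of_forall_add_uvec_eq (f := fieldOf d L φ) fun x i =>
    sub_eq_zero.1 (congrFun hφ (x, i))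
  have hsum : ∑ x, fieldOf d L φ x = 0 := φ.2
  have h0 : fieldOf d L φ 0 = 0 := by
    rw [Finset.sum_congr rfl fun x _ => hconst x, Finset.sum_const, Finset.card_univ,
      smul_eq_zero] at hsum
    exact hsum.resolve_left Fintype.card_ne_zero
  ext x
  exact (hconst x).trans h0

/-- The map sending a tilt `p` to the constant gradient field `(x, i) ↦ p i`. -/
def tiltMap (d L : ℕ) : (Fin d → ℝ) →L[ℝ] (Torus d L × Fin d → ℝ) :=
  ContinuousLinearMap.pi fun k => ContinuousLinearMap.proj k.2

theorem hamiltonian_eq_sum (d L : ℕ) (V : ℝ → ℝ) (p : Fin d → ℝ) (φ : ↥(OmegaZero d L)) :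
    hamiltonian d L V p (fieldOf d L φ) = ∑ k, V ((tiltMap d L p + discreteGrad d L φ) k) := by
  simp [hamiltonian, Fintype.sum_prod_type, tiltMap, add_sub_assoc]

end Torus

/-- For every `L ≥ 1`, the partition function satisfies `0 < Z_L(p) < ∞`
(finiteness being integrability of `exp(-H_{L,p})` on `Ω°_L`), the finite-volume surface
tension `σ_L` is differentiable, and `∇σ_L(p)` equals the expectation under the Gibbs
measure `μ_{L,p}` of the spatially averaged flux `V'(p + ∇φ)`. -/
theorem gradient_sigmaL_gibbs_representation
    (d : ℕ) (hd : 2 ≤ d)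
    (V V' : ℝ → ℝ) (cm cp : ℝ) (hc : 0 < cm) (hcc : cm ≤ cp)
    (hsymm : ∀ x : ℝ, V (-x) = V x)
    (hV' : ∀ x : ℝ, HasDerivAt V (V' x) x)
    (hconv : ∀ a b : ℝ, a ≤ b →
      cm * (b - a) ≤ V' b - V' a ∧ V' b - V' a ≤ cp * (b - a)) :
    ∀ L : ℕ, 1 ≤ L →
      (∀ p : Fin d → ℝ,
        Integrable (fun φ : ↥(OmegaZero d L) =>
          Real.exp (-(hamiltonian d L V p (fieldOf d L φ)))) ∧
        0 < partitionZ d L V p) ∧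
      Differentiable ℝ (sigmaL d L V) ∧
      ∀ (p : Fin d → ℝ) (i : Fin d),
        fderiv ℝ (sigmaL d L V) p (Pi.single i 1)
          = (partitionZ d L V p)⁻¹ *
              ∫ φ : ↥(OmegaZero d L),
                (((2 * (L : ℝ) + 1) ^ d)⁻¹ *
                    ∑ x : Torus d L,
                      V' (p i + fieldOf d L φ (x + uvec d L i) - fieldOf d L φ x)) *
                  Real.exp (-(hamiltonian d L V p (fieldOf d L φ))) := by
  intro L _
  set G : (Torus d L × Fin d → ℝ) → ℝ := fun y => ∑ k, V (y k) with hGdef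
  set G' : (Torus d L × Fin d → ℝ) → (Torus d L × Fin d → ℝ) →L[ℝ] ℝ :=
    fun y => ∑ k, V' (y k) • ContinuousLinearMap.proj k with hG'def
  have hV'c := continuous_deriv_of_bounds hc hconv
  have hGd : ∀ y, HasFDerivAt G (G' y) y := hasFDerivAt_sum_comp_apply hV'
  have hGc : Continuous G := continuous_iff_continuousAt.2 fun y => (hGd y).continuousAt
  have hG'c : Continuous G' := by fun_prop
  have hG : ∀ y, Fintype.card (Torus d L × Fin d) * V 0 + cm / 2 * ‖y‖ ^ 2 ≤ G y := by
    intro y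
    calc _ ≤ Fintype.card (Torus d L × Fin d) * V 0 + cm / 2 * ∑ k, y k ^ 2 := by
          gcongr
          exact sq_norm_pi_le_sum_sq y
      _ = ∑ k, (V 0 + cm / 2 * y k ^ 2) := by
          rw [Finset.sum_add_distrib, Finset.mul_sum, Finset.sum_const, Finset.card_univ,
            nsmul_eq_mul]
      _ ≤ G y := Finset.sum_le_sum fun k _ =>
          quadratic_lower_bound hsymm hV' (fun a b hab => (hconv a b hab).1) _
  have hcp : 0 ≤ cp := hc.le.trans hcc
  have hG'b : ∀ y, ‖G' y‖ ≤ Fintype.card (Torus d L × Fin d) * cp * ‖y‖ :=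
    norm_sum_smul_proj_le hcp (abs_deriv_le hc hsymm hV' hconv)
  have hint (p : Fin d → ℝ) : Integrable (fun φ : ↥(OmegaZero d L) =>
      Real.exp (-(hamiltonian d L V p (fieldOf d L φ)))) := by
    simp only [hamiltonian_eq_sum]
    exact integrable_exp_neg_energy hGc (half_pos hc) hG (discreteGrad d L)
      (discreteGrad_injective d L) (tiltMap d L p)
  have hpos (p : Fin d → ℝ) : 0 < partitionZ d L V p := integral_exp_pos (hint p)
  have hZ (p : Fin d → ℝ) := hasFDerivAt_integral_exp_neg_energy hGd hG'c (half_pos hc)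
    (by positivity) hG hG'b (discreteGrad d L) (discreteGrad_injective d L) (tiltMap d L) p
  have hZeq : partitionZ d L V = fun p => ∫ φ : ↥(OmegaZero d L),
      Real.exp (-G (tiltMap d L p + discreteGrad d L φ)) := by
    ext p
    simp only [partitionZ, hamiltonian_eq_sum, hGdef]
  have hsigma (p : Fin d → ℝ) :=
    ((hZeq ▸ (hZ p).2 : HasFDerivAt (partitionZ d L V) _ p).log (hpos p).ne').const_mul
      (-(((2 * (L : ℝ) + 1) ^ d)⁻¹))
  refine ⟨fun p => ⟨hint p, hpos p⟩, fun p => (hsigma p).differentiableAt, fun p i => ?_⟩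
  have hfd := (hsigma p).fderiv
  change fderiv ℝ (sigmaL d L V) p = _ at hfd
  rw [hfd, smul_apply, smul_apply,
    ContinuousLinearMap.integral_apply (hZ p).1, smul_eq_mul, smul_eq_mul, mul_left_comm,
    ← integral_const_mul]
  congr 1
  refine integral_congr_ae (Eventually.of_forall fun φ => ?_)
  have hflux : G' (tiltMap d L p + discreteGrad d L φ) (tiltMap d L (Pi.single i 1))
      = ∑ x : Torus d L, V' (p i + fieldOf d L φ (x + uvec d L i) - fieldOf d L φ x) := by
    simp [hG'def, tiltMap, Fintype.sum_prod_type, Pi.single_apply, add_sub_assoc]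
  simp only [smul_apply, neg_apply,
    ContinuousLinearMap.comp_apply, smul_eq_mul, hamiltonian_eq_sum, hflux, hGdef]
  ring
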